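/- Let X and Y be compact Hausdorff spaces and let C(X,ℝ) denote the space of continuous real-valued functions on X. A linear bijection T : C(X,ℝ) → C(Y,ℝ) is diameter-preserving if and only if there exist a homeomorphism φ : Y → X, a linear functional μ : C(X,ℝ) → ℝ, and a number λ ∈ ℝ with |λ| = 1 and λ ≠ −μ(1_X), such that T(f)(y) = λ·f(φ(y)) + μ(f) for every y ∈ Y and every f ∈ C(X,ℝ). -/

import Mathlib

/-- A map between continuous real-valued function spaces is diameter-preserving if it
preserves the diameter of the range of every function. -/
def DiamPreservingReal {X Y : Type*} [TopologicalSpace X] [TopologicalSpace Y]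
    (T : C(X, ℝ) → C(Y, ℝ)) : Prop :=
  ∀ f : C(X, ℝ), Metric.diam (Set.range (T f)) = Metric.diam (Set.range f)

section DiamPreserving

variable {X Y : Type*} [TopologicalSpace X] [TopologicalSpace Y]

theorem ContinuousMap.diam_range_le (f : C(X, ℝ)) {r : ℝ} (hr : 0 ≤ r)
    (h : ∀ x x', f x - f x' ≤ r) : Metric.diam (Set.range f) ≤ r := by
  refine Metric.diam_le_of_forall_dist_le hr ?_
  rintro _ ⟨x, rfl⟩ _ ⟨x', rfl⟩
  rw [Real.dist_eq, abs_le]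
  constructor <;> linarith [h x x', h x' x]

/-- A map into a compact Hausdorff space is continuous as soon as its compositions with
real-valued continuous functions are. -/
theorem continuous_of_forall_continuous_comp [CompactSpace X] [T2Space X] {φ : Y → X}
    (h : ∀ f : C(X, ℝ), Continuous fun y => f (φ y)) : Continuous φ := by
  refine continuous_iff_continuousAt.2 fun y s hs => Filter.mem_map.2 ?_
  obtain ⟨U, hUs, hU, hyU⟩ := mem_nhds_iff.1 hs
  obtain ⟨f, hf₀, hf₁, -⟩ := exists_continuous_zero_one_of_isClosed
    (isClosed_singleton (x := φ y)) hU.isClosed_compl (by simpa using hyU)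
  have hf₀ : f (φ y) = 0 := hf₀ rfl
  have hev := (h f).continuousAt.eventually_lt (continuousAt_const (y := (1 : ℝ)))
    (by rw [hf₀]; exact one_pos)
  filter_upwards [hev] with z hz
  exact hUs (by_contra fun hzU => hz.ne (hf₁ hzU))

variable [CompactSpace X] [CompactSpace Y]

theorem ContinuousMap.sub_le_diam_range (f : C(X, ℝ)) (x x' : X) :
    f x - f x' ≤ Metric.diam (Set.range f) := by
  have h := Metric.dist_le_diam_of_mem (isCompact_range f.continuous).isBounded
    (Set.mem_range_self x) (Set.mem_range_self x')
  rw [Real.dist_eq] at h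
  exact (le_abs_self _).trans h

theorem ContinuousMap.exists_sub_eq_diam_range [Nonempty X] (f : C(X, ℝ)) :
    ∃ x x', f x - f x' = Metric.diam (Set.range f) := by
  obtain ⟨x, -, hx⟩ := isCompact_univ.exists_isMaxOn Set.univ_nonempty f.continuous.continuousOn
  obtain ⟨x', -, hx'⟩ := isCompact_univ.exists_isMinOn Set.univ_nonempty f.continuous.continuousOn
  have hmax : ∀ z, f z ≤ f x := fun z => hx (Set.mem_univ z)
  have hmin : ∀ z, f x' ≤ f z := fun z => hx' (Set.mem_univ z)
  refine ⟨x, x', le_antisymm (f.sub_le_diam_range x x') (f.diam_range_le ?_ fun z z' => ?_)⟩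
  · linarith [hmax x']
  · linarith [hmax z, hmin z']

/-- Every continuous function is a difference of two continuous functions that both attain their
maximum at `y₁` and their minimum at `y₂`. -/
theorem ContinuousMap.exists_add_extremal_at [T2Space Y] {y₁ y₂ : Y} (hy : y₁ ≠ y₂)
    (g : C(Y, ℝ)) : ∃ h : C(Y, ℝ), (∀ y, h y ≤ h y₁ ∧ h y₂ ≤ h y) ∧
      ∀ y, (g + h) y ≤ (g + h) y₁ ∧ (g + h) y₂ ≤ (g + h) y := by
  obtain ⟨u, hu₂, hu₁, hu⟩ := exists_continuous_zero_one_of_isClosed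
    (isClosed_singleton (x := y₂)) (isClosed_singleton (x := y₁)) (by simpa using hy.symm)
  have hu₁ : u y₁ = 1 := hu₁ rfl
  have hu₂ : u y₂ = 0 := hu₂ rfl
  let a : C(Y, ℝ) := ⟨fun y => |g y - g y₁|, by fun_prop⟩
  let b : C(Y, ℝ) := ⟨fun y => |g y - g y₂|, by fun_prop⟩
  let h : C(Y, ℝ) := ⟨fun y => u y * (4 * ‖g‖ - a y) + (1 - u y) * b y, by fun_prop⟩
  have hg : ∀ y, -‖g‖ ≤ g y ∧ g y ≤ ‖g‖ := fun y => abs_le.1 (g.norm_coe_le_norm y)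
  have ha : ∀ y, 0 ≤ a y := fun y => abs_nonneg _
  have hb : ∀ y, 0 ≤ b y := fun y => abs_nonneg _
  have ha' : ∀ y, a y ≤ 2 * ‖g‖ := fun y =>
    abs_le.2 ⟨by linarith [hg y, hg y₁], by linarith [hg y, hg y₁]⟩
  have hb' : ∀ y, b y ≤ 2 * ‖g‖ := fun y =>
    abs_le.2 ⟨by linarith [hg y, hg y₂], by linarith [hg y, hg y₂]⟩
  have hh : ∀ y, h y = u y * (4 * ‖g‖ - a y) + (1 - u y) * b y := fun y => rfl
  have hay : a y₁ = 0 := by simp [a]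
  have hby : b y₂ = 0 := by simp [b]
  have key₁ : ∀ y, a y ≤ h y₁ - h y := by
    intro y
    rw [hh, hh, hu₁, hay]
    nlinarith [mul_nonneg (sub_nonneg.2 (hu y).2)
      (show 0 ≤ 4 * ‖g‖ - b y - a y by linarith [ha' y, hb' y])]
  have key₂ : ∀ y, b y ≤ h y - h y₂ := by
    intro y
    rw [hh, hh, hu₂, hby]
    nlinarith [mul_nonneg (hu y).1 (show 0 ≤ 4 * ‖g‖ - b y - a y by linarith [ha' y, hb' y])]
  refine ⟨h, fun y => ⟨by linarith [key₁ y, ha y], by linarith [key₂ y, hb y]⟩, fun y => ⟨?_, ?_⟩⟩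
  · have : g y - g y₁ ≤ a y := le_abs_self _
    simp only [ContinuousMap.add_apply]
    linarith [key₁ y]
  · have : -(g y - g y₂) ≤ b y := neg_le_abs _
    simp only [ContinuousMap.add_apply]
    linarith [key₂ y]

theorem DiamPreservingReal.exists_sub_eq_sub [Nonempty X] [T2Space Y]
    {T : C(X, ℝ) →ₗ[ℝ] C(Y, ℝ)} (hT : DiamPreservingReal T) (hsurj : Function.Surjective T)
    {y₁ y₂ : Y} (hy : y₁ ≠ y₂) :
    ∃ x₁ x₂ : X, ∀ f, T f y₁ - T f y₂ = f x₁ - f x₂ := by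
  let F : Set C(X, ℝ) := {f | T f y₁ - T f y₂ = Metric.diam (Set.range f)}
  have hF : ∀ f, (∀ y, T f y ≤ T f y₁ ∧ T f y₂ ≤ T f y) → f ∈ F := by
    intro f hf
    refine le_antisymm ((T f).sub_le_diam_range _ _ |>.trans_eq (hT f)) ?_
    rw [← hT f]
    refine (T f).diam_range_le (by linarith [hf y₂]) fun y y' => ?_
    linarith [(hf y).1, (hf y').2]
  have hfin : ∀ s : Finset F, (⋂ f ∈ s, {p : X × X |
      f.1 p.1 - f.1 p.2 = Metric.diam (Set.range f.1)}).Nonempty := by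
    intro s
    obtain ⟨x, x', hx⟩ := (∑ f ∈ s, f.1).exists_sub_eq_diam_range
    have hle := ((T (∑ f ∈ s, f.1)).sub_le_diam_range y₁ y₂).trans_eq (hT _)
    rw [← hx, map_sum] at hle
    simp only [ContinuousMap.coe_sum, Finset.sum_apply, ← Finset.sum_sub_distrib] at hle
    rw [Finset.sum_congr rfl fun f _ => f.2] at hle
    have hle' : ∀ f ∈ s, f.1 x - f.1 x' ≤ Metric.diam (Set.range f.1) :=
      fun f _ => f.1.sub_le_diam_range x x'
    have heq := (Finset.sum_eq_sum_iff_of_le hle').1 (le_antisymm (Finset.sum_le_sum hle') hle)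
    exact ⟨(x, x'), Set.mem_iInter₂.2 heq⟩
  obtain ⟨⟨x₁, x₂⟩, hx⟩ := CompactSpace.iInter_nonempty
    (fun f : F => isClosed_eq (by fun_prop) continuous_const) hfin
  have hx : ∀ f ∈ F, f x₁ - f x₂ = T f y₁ - T f y₂ := fun f hf =>
    (Set.mem_iInter.1 hx ⟨f, hf⟩).trans hf.symm
  refine ⟨x₁, x₂, fun f => ?_⟩
  obtain ⟨h, h₁, h₂⟩ := (T f).exists_add_extremal_at hy
  obtain ⟨k, rfl⟩ := hsurj h
  have e₁ := hx k (hF k h₁)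
  have e₂ := hx (f + k) (hF _ (by simpa only [map_add] using h₂))
  simp only [map_add, ContinuousMap.add_apply] at e₂
  linarith

theorem DiamPreservingReal.eq_or_eq_of_sub_eq_sub [T2Space X]
    {T : C(X, ℝ) →ₗ[ℝ] C(Y, ℝ)} (hT : DiamPreservingReal T) {y₀ y y' : Y} {a b a' b' : X}
    (hab : a ≠ b) (hab' : a' ≠ b') (h : ∀ f, T f y - T f y₀ = f a - f b)
    (h' : ∀ f, T f y' - T f y₀ = f a' - f b') : a = a' ∨ b = b' := by
  by_contra! hne
  obtain ⟨f, hf₀, hf₁, hf⟩ := exists_continuous_zero_one_of_isClosed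
    (s := {b, a'}) (t := {a, b'}) (Set.toFinite _).isClosed (Set.toFinite _).isClosed (by
      simp only [Set.disjoint_insert_left, Set.disjoint_singleton_left, Set.mem_insert_iff,
        Set.mem_singleton_iff, not_or]
      exact ⟨⟨hab.symm, hne.2⟩, hne.1.symm, hab'⟩)
  have hb : f b = 0 := hf₀ (by simp)
  have ha' : f a' = 0 := hf₀ (by simp)
  have ha : f a = 1 := hf₁ (by simp)
  have hb' : f b' = 1 := hf₁ (by simp)
  have hd : Metric.diam (Set.range f) ≤ 1 :=
    f.diam_range_le zero_le_one fun x x' => by linarith [(hf x).2, (hf x').1]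
  have := (T f).sub_le_diam_range y y'
  rw [hT f] at this
  linarith [h f, h' f]

theorem DiamPreservingReal.exists_weighted_sub [Nonempty X] [T2Space X] [T2Space Y]
    {T : C(X, ℝ) →ₗ[ℝ] C(Y, ℝ)} (hT : DiamPreservingReal T) (hsurj : Function.Surjective T)
    (y₀ : Y) : ∃ (φ : Y → X) (x₀ : X) (lam : ℝ), |lam| = 1 ∧
      ∀ y f, T f y - T f y₀ = lam * (f (φ y) - f x₀) := by
  classical
  have hsep : ∀ {y y' : Y}, (∀ f, T f y = T f y') → y = y' := by
    intro y y' h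
    by_contra hne
    obtain ⟨u, hu₀, hu₁, -⟩ := exists_continuous_zero_one_of_isClosed
      (isClosed_singleton (x := y)) (isClosed_singleton (x := y')) (by simpa using hne)
    obtain ⟨f, rfl⟩ := hsurj u
    have h₀ : T f y = 0 := hu₀ rfl
    have h₁ : T f y' = 1 := hu₁ rfl
    linarith [h f]
  have hex : ∀ y, ∃ p : X × X, y ≠ y₀ → ∀ f, T f y - T f y₀ = f p.1 - f p.2 := by
    intro y
    by_cases hy : y = y₀
    · exact ⟨Classical.arbitrary _, fun h => absurd hy h⟩
    · obtain ⟨x₁, x₂, h⟩ := hT.exists_sub_eq_sub hsurj hy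
      exact ⟨(x₁, x₂), fun _ => h⟩
  choose p hp using hex
  have hpne : ∀ y, y ≠ y₀ → (p y).1 ≠ (p y).2 := fun y hy heq =>
    hy (hsep fun f => by have := hp y hy f; rw [heq] at this; linarith)
  have hpinj : ∀ y y', y ≠ y₀ → y' ≠ y₀ → (p y).1 = (p y').1 → (p y).2 = (p y').2 → y = y' := by
    intro y y' hy hy' h₁ h₂
    refine hsep fun f => ?_
    have e := hp y hy f
    have e' := hp y' hy' f
    rw [h₁, h₂] at e
    linarith
  have hor : ∀ y y', y ≠ y₀ → y' ≠ y₀ → (p y).1 = (p y').1 ∨ (p y).2 = (p y').2 :=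
    fun y y' hy hy' => hT.eq_or_eq_of_sub_eq_sub (hpne y hy) (hpne y' hy') (hp y hy) (hp y' hy')
  have hline : (∃ x₀, ∀ y, y ≠ y₀ → (p y).2 = x₀) ∨ ∃ x₀, ∀ y, y ≠ y₀ → (p y).1 = x₀ := by
    by_contra! hcon
    obtain ⟨hcon₂, hcon₁⟩ := hcon
    obtain ⟨y₁, hy₁, -⟩ := hcon₂ (Classical.arbitrary X)
    obtain ⟨y₂, hy₂, h₂⟩ := hcon₂ (p y₁).2
    obtain ⟨y₃, hy₃, h₃⟩ := hcon₁ (p y₁).1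
    have := hor y₁ y₂ hy₁ hy₂
    have := hor y₁ y₃ hy₁ hy₃
    have := hor y₂ y₃ hy₂ hy₃
    grind
  rcases hline with ⟨x₀, hx₀⟩ | ⟨x₀, hx₀⟩
  · refine ⟨fun y => if y = y₀ then x₀ else (p y).1, x₀, 1, by simp, fun y f => ?_⟩
    by_cases hy : y = y₀
    · simp [hy]
    · simp [hy, hp y hy f, hx₀ y hy]
  · refine ⟨fun y => if y = y₀ then x₀ else (p y).2, x₀, -1, by simp, fun y f => ?_⟩
    by_cases hy : y = y₀
    · simp [hy]
    · simp [hy, hp y hy f, hx₀ y hy]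

theorem DiamPreservingReal.exists_representation [Nonempty Y] [T2Space X] [T2Space Y]
    {T : C(X, ℝ) →ₗ[ℝ] C(Y, ℝ)} (hT : DiamPreservingReal T) (hbij : Function.Bijective T) :
    ∃ (φ : Y ≃ₜ X) (μ : C(X, ℝ) →ₗ[ℝ] ℝ) (lam : ℝ), |lam| = 1 ∧ lam ≠ -μ 1 ∧
      ∀ (y : Y) (f : C(X, ℝ)), T f y = lam * f (φ y) + μ f := by
  have hX : Nonempty X := by
    by_contra hX
    rw [not_nonempty_iff] at hX
    have : Subsingleton C(Y, ℝ) := hbij.2.subsingleton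
    exact zero_ne_one (Subsingleton.elim (0 : C(Y, ℝ)) 1)
  obtain ⟨y₀⟩ := ‹Nonempty Y›
  obtain ⟨φ, x₀, lam, hlam, h⟩ := hT.exists_weighted_sub hbij.2 y₀
  have hlam₀ : lam ≠ 0 := by rintro rfl; simp at hlam
  let μ : C(X, ℝ) →ₗ[ℝ] ℝ :=
    { toFun := fun f => T f y₀ - lam * f x₀
      map_add' := fun f g => by simp only [map_add, ContinuousMap.add_apply]; ring
      map_smul' := fun c f => by
        simp only [map_smul, ContinuousMap.smul_apply, smul_eq_mul, RingHom.id_apply]; ring }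
  have hrep : ∀ y f, T f y = lam * f (φ y) + μ f := fun y f => by
    have : μ f = T f y₀ - lam * f x₀ := rfl
    rw [this]
    linarith [h y f]
  have hφ : Continuous φ := by
    refine continuous_of_forall_continuous_comp fun f => ?_
    have : (fun y => f (φ y)) = fun y => (T f y - μ f) / lam := by
      ext y
      rw [hrep y f]
      field_simp
      ring
    rw [this]
    fun_prop
  have hinj : Function.Injective φ := by
    intro y y' hyy
    by_contra hne
    obtain ⟨u, hu₀, hu₁, -⟩ := exists_continuous_zero_one_of_isClosed
      (isClosed_singleton (x := y)) (isClosed_singleton (x := y')) (by simpa using hne)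
    obtain ⟨f, rfl⟩ := hbij.2 u
    have h₀ : T f y = 0 := hu₀ rfl
    have h₁ : T f y' = 1 := hu₁ rfl
    rw [hrep, hyy, ← hrep, h₁] at h₀
    exact one_ne_zero h₀
  have hsurj : Function.Surjective φ := by
    intro x
    by_contra hx
    obtain ⟨f, hf₀, hf₁, -⟩ := exists_continuous_zero_one_of_isClosed
      (isCompact_range hφ).isClosed (isClosed_singleton (x := x)) (by simpa using hx)
    have hf₀ : ∀ y, f (φ y) = 0 := fun y => hf₀ ⟨y, rfl⟩
    have hf₁ : f x = 1 := hf₁ rfl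
    have hd : Metric.diam (Set.range (T f)) ≤ 0 :=
      (T f).diam_range_le le_rfl fun y y' => by rw [hrep, hrep, hf₀, hf₀, sub_self]
    have := f.sub_le_diam_range x (φ y₀)
    rw [← hT f, hf₁, hf₀] at this
    linarith
  refine ⟨hφ.homeoOfEquivCompactToT2 (f := Equiv.ofBijective φ ⟨hinj, hsurj⟩), μ, lam, hlam,
    fun hμ => ?_, hrep⟩
  have hT₁ : T 1 = 0 := by
    ext y
    rw [hrep, hμ]
    simp
  exact one_ne_zero (hbij.1 (hT₁.trans (map_zero T).symm))

end DiamPreserving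

theorem diamPreserving_bijection_representation_real
    {X Y : Type*} [TopologicalSpace X] [CompactSpace X] [T2Space X]
    [TopologicalSpace Y] [CompactSpace Y] [T2Space Y]
    (T : C(X, ℝ) →ₗ[ℝ] C(Y, ℝ)) (hbij : Function.Bijective T) :
    DiamPreservingReal ⇑T ↔
      ∃ (φ : Y ≃ₜ X) (μ : C(X, ℝ) →ₗ[ℝ] ℝ) (lam : ℝ),
        |lam| = 1 ∧ lam ≠ -μ 1 ∧
        ∀ (y : Y) (f : C(X, ℝ)), T f y = lam * f (φ y) + μ f := by
  constructor
  · intro hT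
    rcases isEmpty_or_nonempty Y with hY | hY
    · have hX : IsEmpty X := by
        by_contra hX
        rw [not_isEmpty_iff] at hX
        have : Subsingleton C(X, ℝ) := hbij.1.subsingleton
        exact zero_ne_one (Subsingleton.elim (0 : C(X, ℝ)) 1)
      exact ⟨Homeomorph.empty, 0, 1, by simp, by simp, fun y => hY.elim y⟩
    · exact hT.exists_representation hbij
  · rintro ⟨φ, μ, lam, hlam, -, hrep⟩ f
    have hiso : Isometry fun t : ℝ => lam * t + μ f := Isometry.of_dist_eq fun s t => by
      rw [Real.dist_eq, Real.dist_eq, add_sub_add_right_eq_sub, ← mul_sub, abs_mul, hlam, one_mul]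
    have hrange : Set.range (T f) = (fun t : ℝ => lam * t + μ f) '' Set.range f := by
      rw [← Set.range_comp, ← φ.surjective.range_comp]
      exact congrArg Set.range (funext fun y => hrep y f)
    rw [hrange, hiso.diam_image]
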